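/- arXiv:2408.15705 — 4 statements merged into one kernel-verified Lean document; each statement's English description precedes it below -/
import Mathlib

section
/- Let α > 0 and β > 0 be real numbers satisfying 2α² + (3/2)β < 1/2. Then the symmetric 2×2 real matrix Φ_{α,β} = [[α² − 1/2 + β, αβ], [αβ, β² − β]] is negative definite, i.e., for every nonzero vector (a,b) ∈ ℝ² one has (a,b)ᵀ Φ_{α,β} (a,b) < 0. -/
open Matrix

/-- for `α, β > 0` with `2α² + (3/2)β < 1/2`, the matrix
`Φ_{α,β} = [[α² − 1/2 + β, αβ], [αβ, β² − β]]` is negative definite. -/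
theorem Phi_neg_def (α β : ℝ) (hα : 0 < α) (hβ : 0 < β)
    (hcond : 2 * α ^ 2 + (3 / 2) * β < 1 / 2) :
    ∀ x : Fin 2 → ℝ, x ≠ 0 →
      x ⬝ᵥ (!![α ^ 2 - 1 / 2 + β, α * β; α * β, β ^ 2 - β]).mulVec x < 0 := by
  intro x hx
  have hβ' : β < 1 / 3 := by nlinarith [sq_nonneg α]
  have hP : 0 < 1 / 2 - β - α ^ 2 := by nlinarith
  have hdet : 0 < (1 / 2 - β - α ^ 2) * (β - β ^ 2) - (α * β) ^ 2 := by
    have h : 0 < (1 / 2 - β) * (1 - β) - α ^ 2 := by nlinarith [sq_nonneg β]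
    have := mul_pos hβ h
    linarith
  simp only [dotProduct, mulVec, Fin.sum_univ_two, of_apply, cons_val_zero, cons_val_one,
    cons_val', cons_val_fin_one]
  by_cases hb : x 1 = 0
  · have ha : x 0 ≠ 0 := by
      intro ha
      apply hx
      ext i
      fin_cases i
      · exact ha
      · exact hb
    have := mul_pos hP (sq_pos_of_ne_zero ha)
    rw [hb]
    linarith
  · have h₁ := mul_pos hdet (sq_pos_of_ne_zero hb)
    have h₂ := sq_nonneg ((1 / 2 - β - α ^ 2) * x 0 - α * β * x 1)
    refine neg_of_mul_neg_right (a := 1 / 2 - β - α ^ 2) ?_ hP.le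
    linarith
end

section
/- Let α > 0 and β > 0 be real numbers satisfying 2α² + (3/2)β < 1/2. Then the symmetric 2×2 real matrix Φ̃_{α,β} = [[2α² + β − 1, αβ], [αβ, 2β² − β]] is negative definite, i.e., for every nonzero vector (a,b) ∈ ℝ² one has (a,b)ᵀ Φ̃_{α,β} (a,b) < 0. -/
open Matrix

/-- for `α, β > 0` with `2α² + (3/2)β < 1/2`, the matrix
`Φ̃_{α,β} = [[2α² + β − 1, αβ], [αβ, 2β² − β]]` is negative definite. -/
theorem PhiTilde_neg_def (α β : ℝ) (hα : 0 < α) (hβ : 0 < β)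
    (hcond : 2 * α ^ 2 + (3 / 2) * β < 1 / 2) :
    ∀ x : Fin 2 → ℝ, x ≠ 0 →
      x ⬝ᵥ (!![2 * α ^ 2 + β - 1, α * β; α * β, 2 * β ^ 2 - β]).mulVec x < 0 := by
  intro x hx
  have hβ3 : β < 1 / 3 := by nlinarith [sq_nonneg α]
  have hα4 : α ^ 2 < 1 / 4 := by linarith
  have hp : 2 * α ^ 2 + β - 1 + 3 * α ^ 2 * β < 0 := by
    nlinarith [mul_pos hβ (sub_pos.2 hα4)]
  have hq : 2 * β ^ 2 - β + β / 3 < 0 := by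
    nlinarith [mul_pos hβ (sub_pos.2 hβ3)]
  have key : x ⬝ᵥ (!![2 * α ^ 2 + β - 1, α * β; α * β, 2 * β ^ 2 - β]).mulVec x =
      (2 * α ^ 2 + β - 1 + 3 * α ^ 2 * β) * x 0 ^ 2 + (2 * β ^ 2 - β + β / 3) * x 1 ^ 2
        - β / 3 * (3 * α * x 0 - x 1) ^ 2 := by
    simp [dotProduct, mulVec, Fin.sum_univ_two]
    ring
  rw [key]
  have hsq : 0 ≤ β / 3 * (3 * α * x 0 - x 1) ^ 2 := by positivity
  by_cases h0 : x 0 = 0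
  · have h1 : x 1 ≠ 0 := fun h1 => hx <| by
      ext i
      fin_cases i <;> simp [h0, h1]
    have h := mul_neg_of_neg_of_pos hq (pow_pos (abs_pos.2 h1) 2)
    rw [sq_abs] at h
    nlinarith [mul_nonneg (neg_nonneg.2 hp.le) (sq_nonneg (x 0))]
  · have h := mul_neg_of_neg_of_pos hp (pow_pos (abs_pos.2 h0) 2)
    rw [sq_abs] at h
    nlinarith [mul_nonneg (neg_nonneg.2 hq.le) (sq_nonneg (x 1))]
end

section
/- Let L > 0, and let α > 0, β > 0 satisfy 2α² + (3/2)β < 1/2. Let μ₁ > 0 and μ₂ > 0 be real numbers satisfying μ₁ < min{(1 − 2β − 2α²)/(2Lα²), (1 − 2α² − 3β)/(L(2α² + β))} and μ₂ < min{(1 − 2β − 2(1+Lμ₁)α²)/(2β), (1 − 2(1+Lμ₁)α² − (1+Lμ₁)β − 2β)/(2β)}. Then the symmetric 2×2 real matrix Ψ_{μ₁,μ₂} = Φ_{α,β} + Lμ₁·[[α², αβ], [αβ, β²]] + μ₂·[[β, 0], [0, 0]] is negative definite. -/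
open Matrix

/-- Sylvester's criterion for a negative definite binary quadratic form. -/
theorem binary_form_neg_of_neg_of_det_pos {p q r x y : ℝ} (hp : p < 0)
    (hdet : 0 < p * r - q ^ 2) (hxy : x ≠ 0 ∨ y ≠ 0) :
    p * x ^ 2 + 2 * q * x * y + r * y ^ 2 < 0 := by
  have key : p * (p * x ^ 2 + 2 * q * x * y + r * y ^ 2) =
      (p * x + q * y) ^ 2 + (p * r - q ^ 2) * y ^ 2 := by ring
  have hpos : 0 < p * (p * x ^ 2 + 2 * q * x * y + r * y ^ 2) := by
    rw [key]
    by_cases hy : y = 0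
    · have hx : x ≠ 0 := hxy.resolve_right (not_not.mpr hy)
      subst hy
      have := hp.ne
      have : 0 < (p * x) ^ 2 := by positivity
      simpa using this
    · have : 0 < (p * r - q ^ 2) * y ^ 2 := by positivity
      linarith [sq_nonneg (p * x + q * y)]
  exact neg_of_mul_pos_right hpos hp.le

/-- for `L > 0`, `α, β > 0` with `2α² + (3/2)β < 1/2`, and `μ₁, μ₂ > 0`
small enough as specified, the matrix
`Ψ_{μ₁,μ₂} = Φ_{α,β} + Lμ₁·[[α², αβ], [αβ, β²]] + μ₂·[[β, 0], [0, 0]]`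
is negative definite. -/
theorem Psi_neg_def (L α β μ₁ μ₂ : ℝ) (hL : 0 < L) (hα : 0 < α) (hβ : 0 < β)
    (hcond : 2 * α ^ 2 + (3 / 2) * β < 1 / 2)
    (hμ₁ : 0 < μ₁) (hμ₂ : 0 < μ₂)
    (hμ₁lt : μ₁ < min ((1 - 2 * β - 2 * α ^ 2) / (2 * L * α ^ 2))
        ((1 - 2 * α ^ 2 - 3 * β) / (L * (2 * α ^ 2 + β))))
    (hμ₂lt : μ₂ < min ((1 - 2 * β - 2 * (1 + L * μ₁) * α ^ 2) / (2 * β))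
        ((1 - 2 * (1 + L * μ₁) * α ^ 2 - (1 + L * μ₁) * β - 2 * β) / (2 * β))) :
    ∀ x : Fin 2 → ℝ, x ≠ 0 →
      x ⬝ᵥ ((!![α ^ 2 - 1 / 2 + β, α * β; α * β, β ^ 2 - β]
          + (L * μ₁) • !![α ^ 2, α * β; α * β, β ^ 2]
          + μ₂ • !![β, 0; 0, 0]).mulVec x) < 0 := by
  intro x hx
  have hk : 0 < 1 + L * μ₁ := by positivity
  obtain ⟨h₁, h₂⟩ := lt_min_iff.mp hμ₂lt
  rw [lt_div_iff₀ (by positivity)] at h₁ h₂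
  have hxy : x 0 ≠ 0 ∨ x 1 ≠ 0 := by
    by_contra! h
    exact hx (funext (Fin.forall_fin_two.mpr h))
  have hdet : 0 < ((1 + L * μ₁) * α ^ 2 - 1 / 2 + β + μ₂ * β) * ((1 + L * μ₁) * β ^ 2 - β)
      - ((1 + L * μ₁) * α * β) ^ 2 := by
    have hm : 0 < (1 + μ₂) * β * ((1 + L * μ₁) * β) := by positivity
    have hfactor : 0 < (1 / 2 - (1 + μ₂) * β) * (1 - (1 + L * μ₁) * β)
        - (1 + L * μ₁) * α ^ 2 := by linarith
    calc 0 < β * ((1 / 2 - (1 + μ₂) * β) * (1 - (1 + L * μ₁) * β)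
        - (1 + L * μ₁) * α ^ 2) := mul_pos hβ hfactor
      _ = _ := by ring
  have hneg := binary_form_neg_of_neg_of_det_pos (by linarith) hdet hxy
  convert hneg using 1
  simp [dotProduct, mulVec, Fin.sum_univ_two]
  ring
end

section
/- Let L > 0 and r > 0. For all continuously differentiable functions u, v : [0,L] → ℝ with v(0) = 0 and (∫₀ᴸ u(x)² dx)^{1/2} ≤ r, one has 3∫₀ᴸ (L − 2x) u(x) v(x) v'(x) dx ≤ 3 L^{3/2} · r · ∫₀ᴸ v'(x)² dx. -/
open intervalIntegral

/-- The Cauchy–Schwarz inequality for continuous functions on an interval. -/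
theorem sq_integral_mul_le {a b : ℝ} (hab : a ≤ b) {f g : ℝ → ℝ} (hf : Continuous f)
    (hg : Continuous g) :
    (∫ x in a..b, f x * g x) ^ 2 ≤ (∫ x in a..b, f x ^ 2) * ∫ x in a..b, g x ^ 2 := by
  have key : ∀ t : ℝ, 0 ≤ (∫ x in a..b, f x ^ 2) * (t * t)
      + (2 * ∫ x in a..b, f x * g x) * t + ∫ x in a..b, g x ^ 2 := by
    intro t
    have hff : IntervalIntegrable (fun x => t * t * f x ^ 2) MeasureTheory.volume a b :=
      Continuous.intervalIntegrable (by fun_prop) _ _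
    have hfg : IntervalIntegrable (fun x => 2 * t * (f x * g x)) MeasureTheory.volume a b :=
      Continuous.intervalIntegrable (by fun_prop) _ _
    have hgg : IntervalIntegrable (fun x => g x ^ 2) MeasureTheory.volume a b :=
      Continuous.intervalIntegrable (by fun_prop) _ _
    have hnonneg : 0 ≤ ∫ x in a..b, (t * f x + g x) ^ 2 :=
      integral_nonneg hab fun x _ => sq_nonneg _
    have hexpand : ∫ x in a..b, (t * f x + g x) ^ 2
        = ∫ x in a..b, (t * t * f x ^ 2 + 2 * t * (f x * g x) + g x ^ 2) := by
      congr 1 with x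
      ring
    rw [hexpand, integral_add (hff.add hfg) hgg, integral_add hff hfg, integral_const_mul,
      integral_const_mul] at hnonneg
    linarith
  have hdiscrim := discrim_le_zero key
  rw [discrim] at hdiscrim
  linarith

/-- A `C¹` function vanishing at `0` is controlled on `[0, L]` by the `L²` norm of its
derivative. -/
theorem sq_le_mul_integral_deriv_sq {L : ℝ} {v : ℝ → ℝ} (hv : ContDiff ℝ 1 v) (hv0 : v 0 = 0)
    {x : ℝ} (hx : x ∈ Set.Icc 0 L) :
    v x ^ 2 ≤ L * ∫ y in (0 : ℝ)..L, deriv v y ^ 2 := by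
  have hd : Continuous (deriv v) := hv.continuous_deriv le_rfl
  have hftc : ∫ y in (0 : ℝ)..x, deriv v y = v x := by
    rw [integral_deriv_eq_sub (fun y _ => (hv.differentiable one_ne_zero) y)
      (hd.intervalIntegrable _ _), hv0, sub_zero]
  have hcs := sq_integral_mul_le hx.1 (continuous_const (y := (1 : ℝ))) hd
  simp only [one_mul, hftc, one_pow, integral_const, sub_zero, smul_eq_mul, mul_one] at hcs
  have hmono : ∫ y in (0 : ℝ)..x, deriv v y ^ 2 ≤ ∫ y in (0 : ℝ)..L, deriv v y ^ 2 :=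
    integral_mono_interval le_rfl hx.1 hx.2 (Filter.Eventually.of_forall fun y => sq_nonneg _)
      ((hd.pow 2).intervalIntegrable _ _)
  exact hcs.trans (mul_le_mul hx.2 hmono (integral_nonneg hx.1 fun y _ => sq_nonneg _)
    (hx.1.trans hx.2))

/-- estimate of the coupled nonlinear term: if `u, v` are `C¹`, `v 0 = 0`
and `(∫₀ᴸ u²)^{1/2} ≤ r`, then `3∫₀ᴸ (L−2x)uvv' ≤ 3L^{3/2}·r·∫₀ᴸ (v')²`. -/
theorem coupled_term_bound (L r : ℝ) (hL : 0 < L) (hr : 0 < r) (u v : ℝ → ℝ)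
    (hu : ContDiff ℝ 1 u) (hv : ContDiff ℝ 1 v) (hv0 : v 0 = 0)
    (hsmall : Real.sqrt (∫ x in (0 : ℝ)..L, u x ^ 2) ≤ r) :
    3 * (∫ x in (0 : ℝ)..L, (L - 2 * x) * u x * v x * deriv v x)
      ≤ 3 * L ^ ((3 : ℝ) / 2) * r * ∫ x in (0 : ℝ)..L, deriv v x ^ 2 := by
  have hd : Continuous (deriv v) := hv.continuous_deriv le_rfl
  have hcu := hu.continuous
  have hcv := hv.continuous
  have hu2 : ∫ x in (0 : ℝ)..L, u x ^ 2 ≤ r ^ 2 := (Real.sqrt_le_left hr.le).1 hsmall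
  have hD : 0 ≤ ∫ x in (0 : ℝ)..L, deriv v x ^ 2 := integral_nonneg hL.le fun x _ => sq_nonneg _
  have hsup := fun x (hx : x ∈ Set.Icc 0 L) => sq_le_mul_integral_deriv_sq hv hv0 hx
  have hcs := sq_integral_mul_le hL.le hcu
    (show Continuous fun x => (L - 2 * x) * v x * deriv v x by fun_prop)
  set D := ∫ x in (0 : ℝ)..L, deriv v x ^ 2 with hD_def
  have hweight : ∫ x in (0 : ℝ)..L, ((L - 2 * x) * v x * deriv v x) ^ 2 ≤ L ^ 2 * (L * D) * D := by
    rw [hD_def, ← integral_const_mul, ← hD_def]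
    refine integral_mono_on hL.le (Continuous.intervalIntegrable (by fun_prop) _ _)
      (Continuous.intervalIntegrable (by fun_prop) _ _) fun x hx => ?_
    have hLx : (L - 2 * x) ^ 2 ≤ L ^ 2 := by nlinarith [mul_nonneg hx.1 (sub_nonneg.2 hx.2)]
    rw [mul_pow, mul_pow]
    gcongr
    exact hsup x hx
  have hpow : (L ^ ((3 : ℝ) / 2)) ^ 2 = L ^ 3 := by
    rw [← Real.rpow_natCast, ← Real.rpow_mul hL.le, ← Real.rpow_natCast]
    norm_num
  have hcongr : ∫ x in (0 : ℝ)..L, (L - 2 * x) * u x * v x * deriv v x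
      = ∫ x in (0 : ℝ)..L, u x * ((L - 2 * x) * v x * deriv v x) := by
    congr 1 with x
    ring
  have hbound : ∫ x in (0 : ℝ)..L, (L - 2 * x) * u x * v x * deriv v x
      ≤ L ^ ((3 : ℝ) / 2) * r * D := by
    rw [hcongr]
    refine le_of_abs_le (abs_le_of_sq_le_sq ?_ (by positivity))
    calc _ ≤ _ := hcs
      _ ≤ r ^ 2 * (L ^ 2 * (L * D) * D) :=
        mul_le_mul hu2 hweight (integral_nonneg hL.le fun x _ => sq_nonneg _) (sq_nonneg r)
      _ = (L ^ ((3 : ℝ) / 2) * r * D) ^ 2 := by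
        rw [mul_pow, mul_pow, hpow]
        ring
  linarith
end
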